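/- arXiv:math/0404040 — 2 statements merged into one kernel-verified Lean document; each statement's English description precedes it below -/
import Mathlib

section
/- If R is a strongly relatively quasi-convex subgroup of G, then R is a hyperbolic group; that is, R is generated by a finite set Y and the Cayley graph Γ(R, Y) with the combinatorial metric is a hyperbolic metric space. -/
namespace RelHyp

variable {G : Type*} [Group G] {Λ : Type*}

/-- Length of a shortest word over the alphabet `S ∪ S⁻¹` representing `g`. -/
noncomputable def wordLength (S : Set G) (g : G) : ℕ :=
  sInf {n | ∃ w : List G, w.length = n ∧ (∀ x ∈ w, x ∈ S ∨ x⁻¹ ∈ S) ∧ w.prod = g}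

/-- The free product `F = (∗_λ H_λ) ∗ F(X)`. -/
abbrev RelFree (H : Λ → Subgroup G) (X : Set G) : Type _ :=
  Monoid.Coprod (Monoid.CoprodI fun l => ↥(H l)) (FreeGroup ↥X)

/-- The canonical homomorphism `ε : F → G`. -/
def relEps (H : Λ → Subgroup G) (X : Set G) : RelFree H X →* G :=
  Monoid.Coprod.lift (Monoid.CoprodI.lift fun l => (H l).subtype)
    (FreeGroup.lift fun x => (x : G))

/-- Letters of the alphabet `X ∪ 𝓗`, where `𝓗 = ⊔_λ (H̃_λ ∖ {1})`. -/
abbrev RelLetter (H : Λ → Subgroup G) (X : Set G) : Type _ :=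
  (Σ l : Λ, {h : ↥(H l) // h ≠ 1}) ⊕ (↥X × Bool)

/-- The image of a letter in the free product `F`. -/
def RelLetter.toF {H : Λ → Subgroup G} {X : Set G} : RelLetter H X → RelFree H X
  | Sum.inl ⟨_, h⟩ => Monoid.Coprod.inl (Monoid.CoprodI.of h.1)
  | Sum.inr (x, b) => Monoid.Coprod.inr (if b then FreeGroup.of x else (FreeGroup.of x)⁻¹)

/-- The element of `G` represented by a letter. -/
def RelLetter.val {H : Λ → Subgroup G} {X : Set G} : RelLetter H X → G
  | Sum.inl ⟨_, h⟩ => (h.1 : G)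
  | Sum.inr (x, b) => if b then (x : G) else (x : G)⁻¹

/-- The index `λ` such that the letter belongs to `H̃_λ`, if any. -/
def RelLetter.hIndex {H : Λ → Subgroup G} {X : Set G} : RelLetter H X → Option Λ
  | Sum.inl ⟨l, _⟩ => some l
  | Sum.inr _ => none

/-- The element of `F` represented by a word over `X ∪ 𝓗`. -/
def wordToF {H : Λ → Subgroup G} {X : Set G} (w : List (RelLetter H X)) : RelFree H X :=
  (w.map RelLetter.toF).prod

/-- `f` is a relative isoperimetric function of the relative presentation `⟨X, H | R⟩`. -/
def IsIsoperFn (H : Λ → Subgroup G) (X : Set G) (R : Set (RelFree H X)) (f : ℕ → ℕ) : Prop :=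
  ∀ w : List (RelLetter H X), relEps H X (wordToF w) = 1 →
    ∃ k ≤ f w.length, ∃ r c : Fin k → RelFree H X,
      (∀ i, r i ∈ R) ∧ wordToF w = (List.ofFn fun i => (c i)⁻¹ * r i * c i).prod

/-- `⟨X, H | R⟩` is a finite relative presentation of `G` w.r.t. the collection `H`. -/
structure IsFiniteRelPres (H : Λ → Subgroup G) (X : Set G) (R : Set (RelFree H X)) : Prop where
  finX : X.Finite
  finR : R.Finite
  surj : Function.Surjective (relEps H X)
  ker : (relEps H X).ker = Subgroup.normalClosure R

/-- `G` is finitely presented relative to the collection of subgroups `H`. -/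
def FinitelyPresentedRel (H : Λ → Subgroup G) : Prop :=
  ∃ (X : Set G) (R : Set (RelFree H X)), IsFiniteRelPres H X R

/-- The relative area of a word representing `1`. -/
noncomputable def relArea (H : Λ → Subgroup G) (X : Set G) (R : Set (RelFree H X))
    (w : List (RelLetter H X)) : ℕ :=
  sInf {k | ∃ r c : Fin k → RelFree H X,
    (∀ i, r i ∈ R) ∧ wordToF w = (List.ofFn fun i => (c i)⁻¹ * r i * c i).prod}

/-- The relative Dehn function of the presentation `⟨X, H | R⟩`. -/
noncomputable def relDehn (H : Λ → Subgroup G) (X : Set G) (R : Set (RelFree H X))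
    (n : ℕ) : ℕ :=
  sSup {a | ∃ w : List (RelLetter H X), w.length ≤ n ∧ relEps H X (wordToF w) = 1 ∧
    a = relArea H X R w}

/-- The relative Dehn function is well-defined (finite for each value of the argument),
i.e. there exists a finite-valued relative isoperimetric function. -/
def DehnWellDefined (H : Λ → Subgroup G) (X : Set G) (R : Set (RelFree H X)) : Prop :=
  ∃ f : ℕ → ℕ, IsIsoperFn H X R f

/-- `f ⪯ g`. -/
def AsympLE (f g : ℕ → ℕ) : Prop := ∃ C K L : ℕ, ∀ n, f n ≤ C * g (K * n) + L * n

/-- `f ∼ g`. -/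
def AsympEquiv (f g : ℕ → ℕ) : Prop := AsympLE f g ∧ AsympLE g f

/-- `G` is hyperbolic relative to `H`: it admits a finite relative presentation with a
linear relative isoperimetric function. -/
def IsRelHyperbolic (H : Λ → Subgroup G) : Prop :=
  ∃ (X : Set G) (R : Set (RelFree H X)), IsFiniteRelPres H X R ∧
    ∃ A B : ℕ, IsIsoperFn H X R fun n => A * n + B

/-- The subnegative closure of `f`. -/
noncomputable def subnegClosure (f : ℕ → ℕ) (n : ℕ) : ℕ :=
  sSup {s | ∃ L : List ℕ, (∀ a ∈ L, 0 < a) ∧ L.sum = n ∧ s = (L.map f).sum}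

/-- A combinatorial path in the Cayley graph `Γ(G, X ∪ 𝓗)`: a starting vertex
together with the word labelling the path. -/
structure RelPath (H : Λ → Subgroup G) (X : Set G) where
  start : G
  word : List (RelLetter H X)

namespace RelPath

variable {H : Λ → Subgroup G} {X : Set G}

/-- The length of the path. -/
def len (p : RelPath H X) : ℕ := p.word.length

/-- The `k`-th vertex of the path. -/
def vertex (p : RelPath H X) (k : ℕ) : G :=
  p.start * ((p.word.take k).map RelLetter.val).prod

/-- The terminal vertex of the path. -/
def finish (p : RelPath H X) : G := p.vertex p.word.length

end RelPath

/-- The combinatorial metric `dist_{X ∪ 𝓗}` on `G`. -/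
noncomputable def relDist (H : Λ → Subgroup G) (X : Set G) (g h : G) : ℕ :=
  wordLength (X ∪ ⋃ l, (H l : Set G)) (g⁻¹ * h)

/-- The relative length `|g|_{X ∪ 𝓗}`. -/
noncomputable def relLen (H : Λ → Subgroup G) (X : Set G) (g : G) : ℕ :=
  wordLength (X ∪ ⋃ l, (H l : Set G)) g

/-- The word metric `dist_X` on `G`. -/
noncomputable def xDist (X : Set G) (g h : G) : ℕ := wordLength X (g⁻¹ * h)

variable {H : Λ → Subgroup G} {X : Set G}

/-- `p` is a `(λ, c)`-quasi-geodesic in `Γ(G, X ∪ 𝓗)`. -/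
def IsQuasiGeodesic (lam c : ℝ) (p : RelPath H X) : Prop :=
  ∀ i j : ℕ, i ≤ j → j ≤ p.len →
    ((j - i : ℕ) : ℝ) ≤ lam * (relDist H X (p.vertex i) (p.vertex j) : ℝ) + c

/-- `p` is a geodesic in `Γ(G, X ∪ 𝓗)`. -/
def IsGeodesic (p : RelPath H X) : Prop :=
  ∀ i j : ℕ, i ≤ j → j ≤ p.len → j - i = relDist H X (p.vertex i) (p.vertex j)

/-- The `k`-th letter of `p` is a letter of `H̃_l`. -/
def LetterIsH (p : RelPath H X) (l : Λ) (k : ℕ) : Prop :=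
  ∃ a, p.word[k]? = some a ∧ a.hIndex = some l

/-- The subpath of `p` consisting of the letters with indices `a, …, b` is an
`H_l`-component of `p` (a maximal nonempty `H_l`-subword). -/
def IsComponent (p : RelPath H X) (l : Λ) (a b : ℕ) : Prop :=
  a ≤ b ∧ b < p.len ∧ (∀ k, a ≤ k → k ≤ b → LetterIsH p l k) ∧
    (a = 0 ∨ ¬ LetterIsH p l (a - 1)) ∧ (b + 1 = p.len ∨ ¬ LetterIsH p l (b + 1))

/-- The `H_l`-components of `p` starting at index `a` and of `q` starting at `a'`
are connected (their vertices lie in the same left coset of `H_l`). -/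
def ConnectedComp (p q : RelPath H X) (l : Λ) (a a' : ℕ) : Prop :=
  (p.vertex a)⁻¹ * q.vertex a' ∈ H l

/-- `p` is a path without backtracking: all of its components are isolated. -/
def NoBacktracking (p : RelPath H X) : Prop :=
  ∀ l a b a' b', IsComponent p l a b → IsComponent p l a' b' →
    ConnectedComp p p l a a' → a = a' ∧ b = b'

/-- The `k`-th vertex of `p` is a phase vertex (not an inner vertex of a component). -/
def IsPhase (p : RelPath H X) (k : ℕ) : Prop :=
  ¬ ∃ l a b, IsComponent p l a b ∧ a < k ∧ k ≤ b

/-- `p` and `q` are `k`-similar: their endpoints are `X`-distance at most `k` apart. -/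
def Similar (k : ℝ) (p q : RelPath H X) : Prop :=
  (xDist X p.start q.start : ℝ) ≤ k ∧ (xDist X p.finish q.finish : ℝ) ≤ k

/-- The Rips thin-triangles condition for `Γ(G, X ∪ 𝓗)` with constant `δ`. -/
def RipsThin (H : Λ → Subgroup G) (X : Set G) (δ : ℝ) : Prop :=
  ∀ p q r : RelPath H X, IsGeodesic p → IsGeodesic q → IsGeodesic r →
    p.finish = q.start → q.finish = r.start → r.finish = p.start →
    ∀ i ≤ p.len, ∃ j : ℕ,
      (j ≤ q.len ∧ (relDist H X (p.vertex i) (q.vertex j) : ℝ) ≤ δ) ∨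
      (j ≤ r.len ∧ (relDist H X (p.vertex i) (r.vertex j) : ℝ) ≤ δ)

/-- The Cayley graph `Γ(G, X ∪ 𝓗)` is a hyperbolic metric space. -/
def CayleyHyperbolic (H : Λ → Subgroup G) (X : Set G) : Prop :=
  ∃ δ : ℝ, 0 ≤ δ ∧ RipsThin H X δ

/-- `R` is a relatively quasi-convex subgroup of `G`. -/
def RelQuasiconvex (H : Λ → Subgroup G) (X : Set G) (R : Subgroup G) : Prop :=
  ∃ σ : ℝ, 0 < σ ∧ ∀ p : RelPath H X, IsGeodesic p → p.start ∈ R → p.finish ∈ R →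
    ∀ k ≤ p.len, ∃ w ∈ R, (xDist X (p.vertex k) w : ℝ) ≤ σ

/-- `R` is a strongly relatively quasi-convex subgroup of `G`. -/
def StronglyRelQuasiconvex (H : Λ → Subgroup G) (X : Set G) (R : Subgroup G) : Prop :=
  RelQuasiconvex H X R ∧ ∀ (g : G) (l : Λ), {x : G | x ∈ R ∧ g * x * g⁻¹ ∈ H l}.Finite

/-- `g` is a hyperbolic element: it is not conjugate to an element of any `H_λ`. -/
def IsHypElt (H : Λ → Subgroup G) (g : G) : Prop :=
  ∀ l : Λ, ∀ x ∈ H l, ¬ IsConj g x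

end RelHyp

namespace RelHyp

/-- A walk from `a` to `b` of length `n` along `adj` such that the left Riemann sum of `f dg`
along the walk equals `s`. -/
inductive Walk {V : Type*} (adj : V → V → Prop) (f g : V → ℝ) : V → V → ℕ → ℝ → Prop
  | nil (a : V) : Walk adj f g a a 0 0
  | cons {a b c : V} {n : ℕ} {s : ℝ} (hab : adj a b) (hw : Walk adj f g b c n s) :
      Walk adj f g a c (n + 1) (f a * (g b - g a) + s)

section Calibration

variable {G : Type*} [Group G] {Λ : Type*} (H : Λ → Subgroup G) (X : Set G)

/-- `f` changes by at most `D` along each edge of `Γ(G, X ∪ 𝓗)`. -/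
def EdgeLipschitz (D : ℝ) (f : G → ℝ) : Prop :=
  (∀ x ∈ X, ∀ u, |f (u * x) - f u| ≤ D) ∧ ∀ l, ∀ h ∈ H l, ∀ u, |f (u * h) - f u| ≤ D

/-- The value of `f` at a chosen representative of the coset `u * H l`. -/
noncomputable def cosetValue (f : G → ℝ) (l : Λ) (u : G) : ℝ :=
  f (QuotientGroup.mk (s := H l) u).out

lemma cosetValue_mul (f : G → ℝ) (l : Λ) (u : G) (h : H l) :
    cosetValue H f l (u * h) = cosetValue H f l u := by
  unfold cosetValue
  rw [QuotientGroup.mk_mul_of_mem u h.2]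

/-- Transport of a potential along the edges labelled by the letter `x`. -/
def edgeShift (f g : G → ℝ) (x : G) : Equiv.Perm (G × ℝ) where
  toFun p := (p.1 * x, p.2 + f p.1 * (g (p.1 * x) - g p.1))
  invFun p := (p.1 * x⁻¹, p.2 - f (p.1 * x⁻¹) * (g p.1 - g (p.1 * x⁻¹)))
  left_inv p := by simp
  right_inv p := by simp

/-- Transport of a potential along the edges labelled by an element of `H l`. -/
noncomputable def cosetShift (f g : G → ℝ) (l : Λ) : H l →* (Equiv.Perm (G × ℝ))ᵐᵒᵖ :=
  MonoidHom.mk' (fun h => MulOpposite.op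
    { toFun := fun p => (p.1 * h, p.2 + cosetValue H f l p.1 * (g (p.1 * h) - g p.1))
      invFun := fun p =>
        (p.1 * (h : G)⁻¹, p.2 - cosetValue H f l p.1 * (g p.1 - g (p.1 * (h : G)⁻¹)))
      left_inv := fun p => by simp [cosetValue_mul]
      right_inv := fun p => by
        have := cosetValue_mul H f l p.1 h⁻¹
        simp only [Subgroup.coe_inv] at this
        simp [this] })
    (fun a b => by
      rw [← MulOpposite.op_mul]
      congr 1
      ext p
      · simp [mul_assoc]
      · simp only [Subgroup.coe_mul, Equiv.coe_fn_mk, Equiv.Perm.coe_mul, Function.comp_apply,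
          cosetValue_mul, mul_assoc]
        ring)

/-- Integration of `f dg` over words in the free product; the integral over a word in a single
`H l` depends only on the end points. -/
noncomputable def transport (f g : G → ℝ) : RelFree H X →* (Equiv.Perm (G × ℝ))ᵐᵒᵖ :=
  Monoid.Coprod.lift (Monoid.CoprodI.lift fun l => cosetShift H f g l)
    (FreeGroup.lift fun x => MulOpposite.op (edgeShift f g (x : G)))

variable {H X}

lemma transport_mul (f g : G → ℝ) (x y : RelFree H X) (p : G × ℝ) :
    (transport H X f g (x * y)).unop p
      = (transport H X f g y).unop ((transport H X f g x).unop p) := by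
  simp

/-- Uniform control of the integral of `f dg` over the element `w` of the free product. -/
structure TransportBound (C : ℝ) (f g : G → ℝ) (w : RelFree H X) (u : G) : Prop where
  fst : ∀ t, ((transport H X f g w).unop (u, t)).1 = u * relEps H X w
  left : |f (u * relEps H X w) - f u| ≤ C
  right : |g (u * relEps H X w) - g u| ≤ C
  shift : ∀ t s, ((transport H X f g w).unop (u, t + s)).2
    = ((transport H X f g w).unop (u, t)).2 + s
  bound : ∀ t, |((transport H X f g w).unop (u, t)).2 - t
    - f u * (g (u * relEps H X w) - g u)| ≤ C

lemma exists_transportBound_mul {D : ℝ} {x y : RelFree H X}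
    (hx : ∃ C, ∀ f g : G → ℝ, EdgeLipschitz H X D f → EdgeLipschitz H X D g →
      ∀ u, TransportBound C f g x u)
    (hy : ∃ C, ∀ f g : G → ℝ, EdgeLipschitz H X D f → EdgeLipschitz H X D g →
      ∀ u, TransportBound C f g y u) :
    ∃ C, ∀ f g : G → ℝ, EdgeLipschitz H X D f → EdgeLipschitz H X D g →
      ∀ u, TransportBound C f g (x * y) u := by
  obtain ⟨C₁, h₁⟩ := hx
  obtain ⟨C₂, h₂⟩ := hy
  refine ⟨C₁ + C₂ + C₁ * C₂, fun f g hf hg u => ?_⟩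
  have a := h₁ f g hf hg u
  have b := h₂ f g hf hg (u * relEps H X x)
  have hC₁ : 0 ≤ C₁ := (abs_nonneg _).trans a.left
  have hC₂ : 0 ≤ C₂ := (abs_nonneg _).trans b.left
  have hC : 0 ≤ C₁ * C₂ := mul_nonneg hC₁ hC₂
  have key : ∀ t, (transport H X f g x).unop (u, t)
      = (u * relEps H X x, ((transport H X f g x).unop (u, t)).2) :=
    fun t => Prod.ext (a.fst t) rfl
  refine ⟨fun t => ?_, ?_, ?_, fun t s => ?_, fun t => ?_⟩
  · rw [transport_mul, key, b.fst, map_mul, mul_assoc]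
  · have h := abs_add_le (f (u * relEps H X x * relEps H X y) - f (u * relEps H X x))
      (f (u * relEps H X x) - f u)
    rw [sub_add_sub_cancel] at h
    rw [map_mul, ← mul_assoc]
    linarith [a.left, b.left]
  · have h := abs_add_le (g (u * relEps H X x * relEps H X y) - g (u * relEps H X x))
      (g (u * relEps H X x) - g u)
    rw [sub_add_sub_cancel] at h
    rw [map_mul, ← mul_assoc]
    linarith [a.right, b.right]
  · rw [transport_mul, transport_mul, key, a.shift, b.shift, ← key]
  · rw [transport_mul, key, map_mul, ← mul_assoc]
    have e₁ := a.bound t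
    set t' := ((transport H X f g x).unop (u, t)).2
    have e₂ := b.bound t'
    set s := ((transport H X f g y).unop (u * relEps H X x, t')).2
    set v := u * relEps H X x
    have e₃ : |(f v - f u) * (g (v * relEps H X y) - g v)| ≤ C₁ * C₂ := by
      rw [abs_mul]
      exact mul_le_mul a.left b.right (abs_nonneg _) hC₁
    have h : s - t - f u * (g (v * relEps H X y) - g u)
        = (t' - t - f u * (g v - g u)) + (s - t' - f v * (g (v * relEps H X y) - g v))
          + (f v - f u) * (g (v * relEps H X y) - g v) := by ring
    rw [h]
    exact (abs_add_three _ _ _).trans (by linarith)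

@[elab_as_elim]
lemma relFree_induction {p : RelFree H X → Prop} (one : p 1)
    (coset : ∀ l (h : H l), p (Monoid.Coprod.inl (Monoid.CoprodI.of h)))
    (gen : ∀ x, p (Monoid.Coprod.inr (FreeGroup.of x)))
    (gen_inv : ∀ x, p (Monoid.Coprod.inr (FreeGroup.of x)⁻¹))
    (mul : ∀ x y, p x → p y → p (x * y)) (w : RelFree H X) : p w := by
  induction w using Monoid.Coprod.induction_on with
  | inl a =>
    induction a using Monoid.CoprodI.induction_on with
    | one => simpa using one
    | of l h => exact coset l h
    | mul x y hx hy => rw [map_mul]; exact mul _ _ hx hy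
  | inr a =>
    induction a using FreeGroup.induction_on with
    | C1 => simpa using one
    | of x => exact gen x
    | inv_of x _ => exact gen_inv x
    | mul x y hx hy => rw [map_mul]; exact mul _ _ hx hy
  | mul x y hx hy => exact mul _ _ hx hy

lemma exists_transportBound (D : ℝ) (w : RelFree H X) :
    ∃ C, ∀ f g : G → ℝ, EdgeLipschitz H X D f → EdgeLipschitz H X D g →
      ∀ u, TransportBound C f g w u := by
  induction w using relFree_induction with
  | one => exact ⟨0, fun f g _ _ u => ⟨by simp, by simp, by simp, by simp, by simp⟩⟩
  | coset l h =>
    refine ⟨D + D * D, fun f g hf hg u => ?_⟩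
    have h₁ := hf.2 l h h.2 u
    have h₂ := hg.2 l h h.2 u
    have hD : 0 ≤ D := (abs_nonneg _).trans h₁
    have hDD := mul_nonneg hD hD
    obtain ⟨k, hk⟩ := QuotientGroup.mk_out_eq_mul (H l) u
    have h₃ : |cosetValue H f l u - f u| ≤ D := by
      rw [cosetValue, hk]
      exact hf.2 l k k.2 u
    have ε : relEps H X (Monoid.Coprod.inl (Monoid.CoprodI.of h)) = h := by simp [relEps]
    have τ : ∀ t, (transport H X f g (Monoid.Coprod.inl (Monoid.CoprodI.of h))).unop (u, t)
        = (u * h, t + cosetValue H f l u * (g (u * h) - g u)) := by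
      intro t; simp [transport, cosetShift]
    refine ⟨fun t => by rw [τ, ε], by rw [ε]; linarith, by rw [ε]; linarith,
      fun t s => by rw [τ, τ]; ring, fun t => ?_⟩
    rw [τ, ε]
    have e : t + cosetValue H f l u * (g (u * h) - g u) - t - f u * (g (u * h) - g u)
        = (cosetValue H f l u - f u) * (g (u * h) - g u) := by ring
    simp only [e, abs_mul]
    linarith [mul_le_mul h₃ h₂ (abs_nonneg _) hD]
  | gen x =>
    refine ⟨D, fun f g hf hg u => ?_⟩
    have h₁ := hf.1 x x.2 u
    have h₂ := hg.1 x x.2 u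
    have ε : relEps H X (Monoid.Coprod.inr (FreeGroup.of x)) = x := by simp [relEps]
    have τ : ∀ t, (transport H X f g (Monoid.Coprod.inr (FreeGroup.of x))).unop (u, t)
        = (u * x, t + f u * (g (u * x) - g u)) := by
      intro t; simp [transport, edgeShift]
    refine ⟨fun t => by rw [τ, ε], by rw [ε]; linarith, by rw [ε]; linarith,
      fun t s => by rw [τ, τ]; ring, fun t => ?_⟩
    rw [τ, ε]
    simpa using (abs_nonneg _).trans h₁
  | gen_inv x =>
    refine ⟨D + D * D, fun f g hf hg u => ?_⟩
    have h₁ := hf.1 x x.2 (u * (x : G)⁻¹)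
    have h₂ := hg.1 x x.2 (u * (x : G)⁻¹)
    rw [inv_mul_cancel_right] at h₁ h₂
    have hD : 0 ≤ D := (abs_nonneg _).trans h₁
    have hDD := mul_nonneg hD hD
    have ε : relEps H X (Monoid.Coprod.inr (FreeGroup.of x)⁻¹) = (x : G)⁻¹ := by simp [relEps]
    have τ : ∀ t, (transport H X f g (Monoid.Coprod.inr (FreeGroup.of x)⁻¹)).unop (u, t)
        = (u * (x : G)⁻¹, t - f (u * (x : G)⁻¹) * (g u - g (u * (x : G)⁻¹))) := by
      intro t
      simp only [transport, Monoid.Coprod.lift_apply_inr, map_inv, FreeGroup.lift_apply_of,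
        MulOpposite.unop_inv, MulOpposite.unop_op]
      rfl
    refine ⟨fun t => by rw [τ, ε], ?_, ?_, fun t s => by rw [τ, τ]; ring, fun t => ?_⟩
    · rw [ε, abs_sub_comm]; linarith
    · rw [ε, abs_sub_comm]; linarith
    · rw [τ, ε]
      set v := u * (x : G)⁻¹
      have e : t - f v * (g u - g v) - t - f u * (g v - g u) = (f u - f v) * (g u - g v) := by
        ring
      simp only [e, abs_mul]
      linarith [mul_le_mul h₁ h₂ (abs_nonneg _) hD]
  | mul x y hx hy => exact exists_transportBound_mul hx hy

lemma wordToF_append (v w : List (RelLetter H X)) :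
    wordToF (v ++ w) = wordToF v * wordToF w := by
  simp [wordToF]

lemma exists_wordToF_eq (w : RelFree H X) : ∃ v : List (RelLetter H X), wordToF v = w := by
  induction w using relFree_induction with
  | one => exact ⟨[], rfl⟩
  | coset l h =>
    by_cases h1 : h = 1
    · exact ⟨[], by simp [h1, wordToF]⟩
    · exact ⟨[Sum.inl ⟨l, h, h1⟩], by simp [wordToF, RelLetter.toF]⟩
  | gen x => exact ⟨[Sum.inr (x, true)], by simp [wordToF, RelLetter.toF]⟩
  | gen_inv x => exact ⟨[Sum.inr (x, false)], by simp [wordToF, RelLetter.toF]⟩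
  | mul x y hx hy =>
    obtain ⟨v, rfl⟩ := hx
    obtain ⟨w, rfl⟩ := hy
    exact ⟨v ++ w, wordToF_append v w⟩

lemma transport_prod_le {C : ℝ} {f g : G → ℝ} (L : List (RelFree H X))
    (hL : ∀ z ∈ L, ∀ u t, ((transport H X f g z).unop (u, t)).1 = u ∧
      |((transport H X f g z).unop (u, t)).2 - t| ≤ C) (u : G) (t : ℝ) :
    |((transport H X f g L.prod).unop (u, t)).2 - t| ≤ L.length * C := by
  induction L generalizing t with
  | nil => simp
  | cons z L ih =>
    obtain ⟨h₁, h₂⟩ := hL z (by simp) u t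
    have h₃ := ih (fun z hz => hL z (by simp [hz])) ((transport H X f g z).unop (u, t)).2
    rw [List.prod_cons, transport_mul, show (transport H X f g z).unop (u, t)
      = (u, ((transport H X f g z).unop (u, t)).2) from Prod.ext h₁ rfl]
    have h := abs_add_le (((transport H X f g L.prod).unop
      (u, ((transport H X f g z).unop (u, t)).2)).2 - ((transport H X f g z).unop (u, t)).2)
      (((transport H X f g z).unop (u, t)).2 - t)
    rw [sub_add_sub_cancel] at h
    push_cast [List.length_cons]
    linarith

lemma transport_conj {C C₁ C₂ : ℝ} {f g : G → ℝ} {r c : RelFree H X} (hr : relEps H X r = 1)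
    (hbr : ∀ u, TransportBound C f g r u) (hc : ∀ u, TransportBound C₁ f g c u)
    (hc' : ∀ u, TransportBound C₂ f g c⁻¹ u) (u : G) (t : ℝ) :
    ((transport H X f g (c⁻¹ * r * c)).unop (u, t)).1 = u ∧
      |((transport H X f g (c⁻¹ * r * c)).unop (u, t)).2 - t| ≤ C := by
  set v := u * relEps H X c⁻¹ with hv
  set t' := ((transport H X f g c⁻¹).unop (u, t)).2
  have h₁ : (transport H X f g c⁻¹).unop (u, t) = (v, t') := Prod.ext ((hc' u).fst t) rfl
  set t'' := ((transport H X f g r).unop (v, t')).2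
  have h₂ : (transport H X f g r).unop (v, t') = (v, t'') :=
    Prod.ext (by rw [(hbr v).fst, hr, mul_one]) rfl
  have h₃ : (transport H X f g c).unop (v, t') = (u, t) := by
    rw [← h₁, ← transport_mul]
    simp
  have h₄ := (hc v).shift t' (t'' - t')
  rw [add_sub_cancel, h₃] at h₄
  have h₅ := (hbr v).bound t'
  rw [hr, mul_one, sub_self, mul_zero, sub_zero] at h₅
  rw [transport_mul, transport_mul, h₁, h₂]
  refine ⟨by rw [(hc v).fst, hv, map_inv, inv_mul_cancel_right], ?_⟩
  rw [h₄]
  simpa using h₅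

lemma exists_word_of_walk {E : Set G} {f g : G → ℝ} {W : G → List (RelLetter H X)}
    (hW : ∀ e, relEps H X (wordToF (W e)) = e) {M : ℕ} (hM : ∀ e ∈ E, (W e).length ≤ M) {C : ℝ}
    (hC : ∀ e ∈ E, ∀ u, TransportBound C f g (wordToF (W e)) u) {a b : G} {n : ℕ} {s : ℝ}
    (hw : Walk (fun x y => x⁻¹ * y ∈ E) f g a b n s) :
    ∃ w : List (RelLetter H X), w.length ≤ M * n ∧ relEps H X (wordToF w) = a⁻¹ * b ∧
      ∀ t, |((transport H X f g (wordToF w)).unop (a, t)).2 - t - s| ≤ C * n := by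
  induction hw with
  | nil a => exact ⟨[], by simp, by simp [wordToF], by simp [wordToF]⟩
  | @cons a b c n s hab hw ih =>
    obtain ⟨w, hl, he, hb⟩ := ih
    refine ⟨W (a⁻¹ * b) ++ w, ?_, ?_, fun t => ?_⟩
    · rw [List.length_append, mul_add, mul_one]
      linarith [hM _ hab]
    · rw [wordToF_append, map_mul, hW, he]
      group
    · have hT := hC _ hab a
      have h₁ := hT.fst t
      have h₂ := hT.bound t
      rw [hW, mul_inv_cancel_left] at h₁ h₂
      rw [wordToF_append, transport_mul,
        show (transport H X f g (wordToF (W (a⁻¹ * b)))).unop (a, t)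
          = (b, ((transport H X f g (wordToF (W (a⁻¹ * b)))).unop (a, t)).2)
        from Prod.ext h₁ rfl]
      set t' := ((transport H X f g (wordToF (W (a⁻¹ * b)))).unop (a, t)).2
      have h₃ := abs_add_le (((transport H X f g (wordToF w)).unop (b, t')).2 - t' - s)
        (t' - t - f a * (g b - g a))
      push_cast
      rw [show ((transport H X f g (wordToF w)).unop (b, t')).2 - t - (f a * (g b - g a) + s)
        = ((transport H X f g (wordToF w)).unop (b, t')).2 - t' - s
          + (t' - t - f a * (g b - g a)) by ring]
      have h₄ := hb t'
      linarith [h₄]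

/-- A linear relative isoperimetric inequality bounds the integral of `f dg` along closed walks
linearly in their length. -/
theorem exists_closed_walk_bound {P : Set (RelFree H X)} (hP : IsFiniteRelPres H X P) {A B : ℕ}
    (hAB : IsIsoperFn H X P fun n => A * n + B) {E : Set G} (hE : E.Finite) (D : ℝ) :
    ∃ K : ℝ, 0 ≤ K ∧ ∀ f g : G → ℝ, EdgeLipschitz H X D f → EdgeLipschitz H X D g →
      ∀ a n s, Walk (fun x y => x⁻¹ * y ∈ E) f g a a n s → |s| ≤ K * (n + 1) := by
  have hsurj : ∀ e : G, ∃ w : List (RelLetter H X), relEps H X (wordToF w) = e := by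
    intro e
    obtain ⟨z, hz⟩ := hP.surj e
    obtain ⟨w, rfl⟩ := exists_wordToF_eq z
    exact ⟨w, hz⟩
  choose W hW using hsurj
  choose T hT using exists_transportBound (H := H) (X := X) D
  obtain ⟨M, hM⟩ := (hE.image fun e => (W e).length).bddAbove
  obtain ⟨C₁, hC₁⟩ := (hE.image fun e => T (wordToF (W e))).bddAbove
  obtain ⟨C₂, hC₂⟩ := (hP.finR.image T).bddAbove
  have mono : ∀ {C C' : ℝ} {f g : G → ℝ} {z : RelFree H X} {u : G}, C ≤ C' →
      TransportBound C f g z u → TransportBound C' f g z u := fun h hz =>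
    ⟨hz.fst, hz.left.trans h, hz.right.trans h, hz.shift, fun t => (hz.bound t).trans h⟩
  refine ⟨|C₁| + |C₂| * (A * M + B), by positivity, fun f g hf hg a n s hw => ?_⟩
  obtain ⟨w, hl, he, hb⟩ := exists_word_of_walk (W := W) hW
    (fun e he => hM (Set.mem_image_of_mem _ he)) (C := |C₁|) (fun e he u => mono
      ((hC₁ (Set.mem_image_of_mem _ he)).trans (le_abs_self _)) (hT _ f g hf hg u)) hw
  rw [inv_mul_cancel] at he
  obtain ⟨k, hk, r, c, hr, hrc⟩ := hAB w he
  have hprod := transport_prod_le (H := H) (X := X) (C := |C₂|) (f := f) (g := g)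
    (List.ofFn fun i => (c i)⁻¹ * r i * c i) (fun z hz u t => by
      obtain ⟨i, rfl⟩ := List.mem_ofFn.1 hz
      have hri : relEps H X (r i) = 1 := by
        rw [← MonoidHom.mem_ker, hP.ker]
        exact Subgroup.subset_normalClosure (hr i)
      exact transport_conj hri (fun u => mono
        ((hC₂ (Set.mem_image_of_mem _ (hr i))).trans (le_abs_self _)) (hT _ f g hf hg u))
        (hT _ f g hf hg) (hT _ f g hf hg) u t) a 0
  rw [← hrc, List.length_ofFn] at hprod
  have hb0 := hb 0
  rw [sub_zero] at hprod hb0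
  have hk' : (k : ℝ) ≤ (A * M + B) * (n + 1) := by
    have h : k ≤ (A * M + B) * (n + 1) :=
      calc k ≤ A * w.length + B := hk
        _ ≤ A * (M * n) + B := by gcongr
        _ ≤ (A * M + B) * (n + 1) := by nlinarith [Nat.zero_le (A * M + B * n)]
    exact_mod_cast h
  have h₁ : |s| ≤ |C₁| * n + k * |C₂| := by
    have := abs_sub_abs_le_abs_sub s (((transport H X f g (wordToF w)).unop (a, 0)).2)
    rw [abs_sub_comm] at this
    linarith
  calc |s| ≤ |C₁| * n + k * |C₂| := h₁
    _ ≤ |C₁| * (n + 1) + ((A * M + B) * (n + 1)) * |C₂| := by gcongr; linarith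
    _ = _ := by ring

end Calibration

section ThinTriangles

variable {V : Type*} {d : V → V → ℕ} {f g : V → ℝ}

namespace Walk

variable {adj : V → V → Prop}

lemma trans {a b c : V} {m n : ℕ} {s t : ℝ} (h : Walk adj f g a b m s)
    (h' : Walk adj f g b c n t) : Walk adj f g a c (m + n) (s + t) := by
  induction h with
  | nil a => simpa using h'
  | cons hab _ ih =>
    rw [add_right_comm, add_assoc (_ * _)]
    exact cons hab (ih h')

lemma of_seq (γ : ℕ → V) {n : ℕ} (hγ : ∀ m < n, adj (γ m) (γ (m + 1))) {c e : ℝ}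
    (hf : ∀ m < n, |f (γ m) - c| ≤ e) (hg : ∀ x y, adj x y → |g y - g x| ≤ 1) :
    ∃ s, Walk adj f g (γ 0) (γ n) n s ∧ |s - c * (g (γ n) - g (γ 0))| ≤ e * n := by
  induction n generalizing γ with
  | zero => exact ⟨0, nil _, by simp⟩
  | succ n ih =>
    obtain ⟨s, hw, hs⟩ := ih (fun m => γ (m + 1)) (fun m hm => hγ (m + 1) (by omega))
      (fun m hm => hf (m + 1) (by omega))
    have h0 := hγ 0 (by omega)
    refine ⟨_, cons h0 hw, ?_⟩
    have h₁ := hf 0 (by omega)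
    have h₂ : |(f (γ 0) - c) * (g (γ (0 + 1)) - g (γ 0))| ≤ e * 1 := by
      rw [abs_mul]
      exact mul_le_mul h₁ (hg _ _ h0) (abs_nonneg _) ((abs_nonneg _).trans h₁)
    have h₃ := abs_add_le ((f (γ 0) - c) * (g (γ (0 + 1)) - g (γ 0)))
      (s - c * (g (γ (n + 1)) - g (γ (0 + 1))))
    rw [show f (γ 0) * (g (γ (0 + 1)) - g (γ 0)) + s - c * (g (γ (n + 1)) - g (γ 0))
      = (f (γ 0) - c) * (g (γ (0 + 1)) - g (γ 0))
        + (s - c * (g (γ (n + 1)) - g (γ (0 + 1)))) by ring]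
    push_cast
    linarith

lemma map {W : Type*} {adj' : W → W → Prop} {f' g' : W → ℝ} (i : V → W)
    (hi : ∀ x y, adj x y → adj' (i x) (i y)) (hf : ∀ x, f' (i x) = f x)
    (hg : ∀ x, g' (i x) = g x) {a b : V} {n : ℕ} {s : ℝ} (h : Walk adj f g a b n s) :
    Walk adj' f' g' (i a) (i b) n s := by
  induction h with
  | nil a => exact nil _
  | cons hab _ ih =>
    rw [← hf, ← hg, ← hg]
    exact cons (hi _ _ hab) ih

end Walk

/-- `d` is the vertex metric of a connected graph. -/
structure IsGraphDist (d : V → V → ℕ) : Prop where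
  self : ∀ x, d x x = 0
  symm : ∀ x y, d x y = d y x
  tri : ∀ x y z, d x z ≤ d x y + d y z
  path : ∀ x y, ∃ γ : ℕ → V, γ 0 = x ∧ γ (d x y) = y ∧ ∀ m < d x y, d (γ m) (γ (m + 1)) ≤ 1

/-- `f` is `1`-Lipschitz for `d`. -/
def NatLipschitz (d : V → V → ℕ) (f : V → ℝ) : Prop := ∀ x y, f x ≤ f y + d x y

/-- The integrals of `f dg` along closed walks are bounded linearly in the length of the walk. -/
def ClosedWalkBound (d : V → V → ℕ) (K : ℝ) : Prop :=
  ∀ f g : V → ℝ, NatLipschitz d f → NatLipschitz d g →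
    ∀ a n s, Walk (fun x y => d x y ≤ 1) f g a a n s → |s| ≤ K * (n + 1)

/-- The sequence `γ` is geodesic on `[0, n]`. -/
def GeodSeq (d : V → V → ℕ) (γ : ℕ → V) (n : ℕ) : Prop :=
  ∀ i j, i ≤ j → j ≤ n → d (γ i) (γ j) = j - i

/-- The geodesic sequences `α` on `[0, a]` and `β` on `[0, b]` are `k`-separated, or one of them is
a single vertex. -/
def Separated (d : V → V → ℕ) (k : ℕ) (α : ℕ → V) (a : ℕ) (β : ℕ → V) (b : ℕ) : Prop :=
  a = 0 ∨ b = 0 ∨ ∀ i ≤ a, ∀ j ≤ b, k ≤ d (α i) (β j)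

lemma Separated.symm (hd : IsGraphDist d) {k a b : ℕ} {α β : ℕ → V}
    (h : Separated d k α a β b) : Separated d k β b α a := by
  rcases h with h | h | h
  · exact Or.inr (Or.inl h)
  · exact Or.inl h
  · exact Or.inr (Or.inr fun i hi j hj => by rw [hd.symm]; exact h j hj i hi)

lemma GeodSeq.step {γ : ℕ → V} {n : ℕ} (h : GeodSeq d γ n) : ∀ m < n, d (γ m) (γ (m + 1)) ≤ 1 :=
  fun m hm => by rw [h m (m + 1) (by omega) (by omega)]; omega

lemma GeodSeq.mono {γ : ℕ → V} {n m : ℕ} (h : GeodSeq d γ n) (hm : m ≤ n) : GeodSeq d γ m :=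
  fun i j hij hj => h i j hij (hj.trans hm)

lemma GeodSeq.reverse (hd : IsGraphDist d) {γ : ℕ → V} {n m : ℕ} (h : GeodSeq d γ n)
    (hm : m ≤ n) : GeodSeq d (fun i => γ (m - i)) m := fun i j hij hj => by
  rw [hd.symm, h _ _ (by omega) (by omega)]
  omega

lemma GeodSeq.shift {γ : ℕ → V} {n m k : ℕ} (h : GeodSeq d γ n)
    (hm : k + m ≤ n) : GeodSeq d (fun i => γ (k + i)) m := fun i j hij hj => by
  rw [h _ _ (by omega) (by omega)]
  omega

lemma NatLipschitz.abs_sub_le (hd : IsGraphDist d) (hf : NatLipschitz d f) (x y : V) :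
    |f x - f y| ≤ d x y := by
  have h₁ := hf x y
  have h₂ := hf y x
  rw [hd.symm] at h₂
  rw [abs_le]
  constructor <;> linarith

lemma natLipschitz_dist (hd : IsGraphDist d) (a : V) : NatLipschitz d fun z => (d a z : ℝ) :=
  fun x y => by
    have := hd.tri a y x
    rw [hd.symm y x] at this
    dsimp only
    exact_mod_cast this

/-- The distance to the set of the first `n + 1` vertices of `γ`, cut off at `k`. -/
noncomputable def cutDist (d : V → V → ℕ) (γ : ℕ → V) (n k : ℕ) (z : V) : ℕ :=
  sInf {m | m = k ∨ ∃ i ≤ n, m = d (γ i) z}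

lemma cutDist_mem (d : V → V → ℕ) (γ : ℕ → V) (n k : ℕ) (z : V) :
    cutDist d γ n k z = k ∨ ∃ i ≤ n, cutDist d γ n k z = d (γ i) z :=
  Nat.sInf_mem (s := {m | m = k ∨ ∃ i ≤ n, m = d (γ i) z}) ⟨k, Or.inl rfl⟩

lemma cutDist_le (d : V → V → ℕ) (γ : ℕ → V) (n k : ℕ) (z : V) : cutDist d γ n k z ≤ k :=
  Nat.sInf_le (Or.inl rfl)

lemma cutDist_le_dist (d : V → V → ℕ) (γ : ℕ → V) {n i : ℕ} (k : ℕ) (hi : i ≤ n) (z : V) :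
    cutDist d γ n k z ≤ d (γ i) z :=
  Nat.sInf_le (Or.inr ⟨i, hi, rfl⟩)

lemma natLipschitz_cutDist (hd : IsGraphDist d) (γ : ℕ → V) (n k : ℕ) :
    NatLipschitz d fun z => (cutDist d γ n k z : ℝ) := fun x y => by
  have : cutDist d γ n k x ≤ cutDist d γ n k y + d x y := by
    rcases cutDist_mem d γ n k y with h | ⟨i, hi, h⟩
    · rw [h]
      exact (cutDist_le d γ n k x).trans (Nat.le_add_right _ _)
    · rw [h, hd.symm x y]
      exact (cutDist_le_dist d γ k hi x).trans (hd.tri _ _ _)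
  dsimp only
  exact_mod_cast this

/-- A hexagon with `k`-separated geodesic long sides `α, β, γ` and short sides of length at most
`k` has `α` of length `O(k)` if `α` is its longest side. -/
lemma hexagon_side_le (hd : IsGraphDist d) {K : ℝ} (hK : 0 ≤ K) (hP : ClosedWalkBound d K)
    {α β γ : ℕ → V} {a b c k : ℕ} (hα : GeodSeq d α a) (hβ : GeodSeq d β b) (hγ : GeodSeq d γ c)
    (hαβ : Separated d k α a β b) (hγα : Separated d k γ c α a)
    (h₁ : d (α a) (β 0) ≤ k) (h₂ : d (β b) (γ 0) ≤ k) (h₃ : d (γ c) (α 0) ≤ k)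
    (hba : b ≤ a) (hca : c ≤ a) :
    (k : ℝ) * a ≤ 3 * k ^ 2 + K * (3 * a + 3 * k + 1) := by
  rcases Nat.eq_zero_or_pos a with ha | ha
  · subst ha
    have : 0 ≤ 3 * (k : ℝ) ^ 2 + K * (3 * (0 : ℕ) + 3 * k + 1) := by positivity
    simpa using this
  set f : V → ℝ := fun z => (cutDist d α a k z : ℝ) with hf
  set g : V → ℝ := fun z => (d (α 0) z : ℝ) with hg
  have hf₁ := natLipschitz_cutDist hd α a k
  have hg₁ := natLipschitz_dist hd (α 0)
  have hg₂ : ∀ x y, d x y ≤ 1 → |g y - g x| ≤ 1 := fun x y hxy => by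
    have := hg₁.abs_sub_le hd y x
    rw [hd.symm y x] at this
    exact this.trans (Nat.cast_le_one.2 hxy)
  have hfk : ∀ z, |f z - k| ≤ k := fun z => by
    have h : f z ≤ k := Nat.cast_le.2 (cutDist_le d α a k z)
    have h' : (0 : ℝ) ≤ f z := Nat.cast_nonneg _
    rw [abs_le]
    constructor <;> linarith
  have hfar : ∀ {δ : ℕ → V} {n : ℕ}, Separated d k α a δ n → ∀ m < n, |f (δ m) - k| ≤ 0 := by
    intro δ n h m hm
    rcases h with h | h | h
    · omega
    · omega
    · have : cutDist d α a k (δ m) = k := by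
        rcases cutDist_mem d α a k (δ m) with h' | ⟨i, hi, h'⟩
        · exact h'
        · exact le_antisymm (cutDist_le _ _ _ _ _) (h' ▸ h i hi m hm.le)
      simp [hf, this]
  have hnear : ∀ m < a, |f (α m) - 0| ≤ 0 := fun m hm => by
    have := cutDist_le_dist d α k hm.le (α m)
    rw [hd.self, Nat.le_zero] at this
    simp [hf, this]
  have hshort : ∀ x y, d x y ≤ k → ∃ n s, n ≤ k ∧ Walk (fun x y => d x y ≤ 1) f g x y n s ∧
      |s - k * (g y - g x)| ≤ k * k := fun x y hxy => by
    obtain ⟨δ, h0, hn, hst⟩ := hd.path x y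
    obtain ⟨s, hw, hs⟩ := Walk.of_seq (f := f) (g := g) (c := k) (e := k) δ hst
      (fun m _ => hfk _) hg₂
    rw [h0, hn] at hw hs
    exact ⟨_, s, hxy, hw, hs.trans (by gcongr)⟩
  obtain ⟨s₁, w₁, e₁⟩ := Walk.of_seq (f := f) (g := g) (c := 0) (e := 0) α hα.step hnear hg₂
  obtain ⟨n₂, s₂, l₂, w₂, e₂⟩ := hshort _ _ h₁
  obtain ⟨s₃, w₃, e₃⟩ := Walk.of_seq (f := f) (g := g) (c := k) (e := 0) β hβ.step (hfar hαβ) hg₂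
  obtain ⟨n₄, s₄, l₄, w₄, e₄⟩ := hshort _ _ h₂
  obtain ⟨s₅, w₅, e₅⟩ := Walk.of_seq (f := f) (g := g) (c := k) (e := 0) γ hγ.step
    (hfar (hγα.symm hd)) hg₂
  obtain ⟨n₆, s₆, l₆, w₆, e₆⟩ := hshort _ _ h₃
  have hw := hP f g hf₁ hg₁ _ _ _ (w₁.trans (w₂.trans (w₃.trans (w₄.trans (w₅.trans w₆)))))
  have hga : g (α a) = a := by simp [hg, hα 0 a (Nat.zero_le _) le_rfl]
  have hg0 : g (α 0) = 0 := by simp [hg, hd.self]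
  have hlen : ((a + (n₂ + (b + (n₄ + (c + n₆)))) : ℕ) : ℝ) + 1 ≤ 3 * a + 3 * k + 1 := by
    have : a + (n₂ + (b + (n₄ + (c + n₆)))) + 1 ≤ 3 * a + 3 * k + 1 := by omega
    exact_mod_cast this
  have hw' := hw.trans (mul_le_mul_of_nonneg_left hlen hK)
  simp only [zero_mul, sub_zero] at e₁ e₃ e₅
  rw [abs_le] at hw' e₁ e₂ e₃ e₄ e₅ e₆
  rw [hga] at e₂
  rw [hg0] at e₆
  nlinarith [hw'.1, e₁.2, e₂.2, e₃.2, e₄.2, e₅.2, e₆.2]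

/-- Any long side of a hexagon with `k`-separated long sides and short sides of length at most `k`
has length at most `7 * k + 1`, if `k` is large. -/
lemma hexagon_le (hd : IsGraphDist d) {K : ℝ} (hK : 0 ≤ K) (hP : ClosedWalkBound d K)
    {α β γ : ℕ → V} {a b c k : ℕ} (hk : 6 * K < k)
    (hα : GeodSeq d α a) (hβ : GeodSeq d β b) (hγ : GeodSeq d γ c)
    (hαβ : Separated d k α a β b) (hβγ : Separated d k β b γ c) (hγα : Separated d k γ c α a)
    (h₁ : d (α a) (β 0) ≤ k) (h₂ : d (β b) (γ 0) ≤ k) (h₃ : d (γ c) (α 0) ≤ k) :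
    a ≤ 7 * k + 1 := by
  have key : ∀ n : ℕ, (k : ℝ) * n ≤ 3 * k ^ 2 + K * (3 * n + 3 * k + 1) → n ≤ 7 * k + 1 := by
    intro n hn
    have hk0 : (0 : ℝ) < k := by linarith
    have hn0 : (0 : ℝ) ≤ n := Nat.cast_nonneg _
    have : K * (3 * n + 3 * k + 1) ≤ k / 6 * (3 * n + 3 * k + 1) := by
      gcongr
      linarith
    have h : (k : ℝ) * n ≤ k * (7 * k + 1) := by nlinarith
    exact_mod_cast le_of_mul_le_mul_left h hk0
  rcases le_total b a with hba | hba
  · rcases le_total c a with hca | hca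
    · exact key a (hexagon_side_le hd hK hP hα hβ hγ hαβ hγα h₁ h₂ h₃ hba hca)
    · exact hca.trans (key c (hexagon_side_le hd hK hP hγ hα hβ hγα hβγ h₃ h₁ h₂ hca
        (hba.trans hca)))
  · rcases le_total c b with hcb | hcb
    · exact hba.trans (key b (hexagon_side_le hd hK hP hβ hγ hα hβγ hαβ h₂ h₃ h₁ hcb hba))
    · exact (hba.trans hcb).trans (key c (hexagon_side_le hd hK hP hγ hα hβ hγα hβγ h₃ h₁ h₂
        (hba.trans hcb) hcb))

/-- A linear bound for integrals along closed walks implies that geodesic triangles are thin. -/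
theorem thin_of_closedWalkBound (hd : IsGraphDist d) {K : ℝ} (hK : 0 ≤ K)
    (hP : ClosedWalkBound d K) {k : ℕ} (hk : 6 * K < k) {p q r : ℕ → V} {a b c : ℕ}
    (hp : GeodSeq d p a) (hq : GeodSeq d q b) (hr : GeodSeq d r c)
    (hpq : p a = q 0) (hqr : q b = r 0) (hrp : r c = p 0) {i : ℕ} (hi : i ≤ a) :
    ∃ j, (j ≤ b ∧ d (p i) (q j) ≤ 6 * k) ∨ (j ≤ c ∧ d (p i) (r j) ≤ 6 * k) := by
  classical
  have hk0 : 0 < k := by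
    have : (0 : ℝ) < k := by linarith
    exact_mod_cast this
  set S : Set V := {z | (∃ j ≤ b, z = q j) ∨ ∃ j ≤ c, z = r j} with hS
  by_contra! hcon
  have hfar : ∀ z ∈ S, 6 * k < d (p i) z := by
    rintro z (⟨j, hj, rfl⟩ | ⟨j, hj, rfl⟩)
    · exact (hcon j).1 hj
    · exact (hcon j).2 hj
  have hside : ∀ z ∈ S, ∃ (δ : ℕ → V) (n : ℕ), GeodSeq d δ n ∧ δ 0 = z ∧ δ n = q b ∧
      ∀ m ≤ n, δ m ∈ S := by
    rintro z (⟨j, hj, rfl⟩ | ⟨j, hj, rfl⟩)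
    · exact ⟨fun m => q (j + m), b - j, hq.shift (by omega), rfl, congrArg q (by omega),
        fun m hm => Or.inl ⟨j + m, by omega, rfl⟩⟩
    · exact ⟨fun m => r (j - m), j, hr.reverse hd hj, rfl, by simp [hqr],
        fun m hm => Or.inr ⟨j - m, by omega, rfl⟩⟩
  let Near : ℕ → Prop := fun m => ∃ z ∈ S, d (p m) z ≤ k
  have near0 : Near 0 := ⟨r c, Or.inr ⟨c, le_rfl, rfl⟩, by simp [hrp, hd.self]⟩
  have neara : Near a := ⟨q 0, Or.inl ⟨0, Nat.zero_le _, rfl⟩, by simp [hpq, hd.self]⟩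
  have near_i : ∀ m ≤ a, Near m → m + 5 * k < i ∨ i + 5 * k < m := by
    rintro m hm ⟨z, hz, hmz⟩
    have h₁ := hfar z hz
    have h₂ := hd.tri (p i) (p m) z
    rcases le_total m i with h | h
    · rw [hd.symm (p i) (p m), hp m i h hi] at h₂
      omega
    · rw [hp i m h hm] at h₂
      omega
  obtain ⟨m₁, hm₁i, ⟨u, hu, hmu⟩, hm₁⟩ : ∃ m₁ ≤ i, Near m₁ ∧ ∀ m, m₁ < m → m ≤ i → ¬ Near m :=
    ⟨Nat.findGreatest Near i, Nat.findGreatest_le _, Nat.findGreatest_spec (Nat.zero_le _) near0,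
      fun m h h' => Nat.findGreatest_is_greatest h h'⟩
  have hex : ∃ m, i ≤ m ∧ m ≤ a ∧ Near m := ⟨a, hi, le_rfl, neara⟩
  obtain ⟨m₂, ⟨him₂, hm₂a, ⟨v, hv, hmv⟩⟩, hm₂⟩ : ∃ m₂, (i ≤ m₂ ∧ m₂ ≤ a ∧ Near m₂) ∧
      ∀ m, i ≤ m → m < m₂ → ¬ Near m :=
    ⟨Nat.find hex, Nat.find_spec hex, fun m him hm hn =>
      Nat.find_min hex hm ⟨him, hm.le.trans (Nat.find_spec hex).2.1, hn⟩⟩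
  have h₁ := near_i m₁ (hm₁i.trans hi) ⟨u, hu, hmu⟩
  have h₂ := near_i m₂ hm₂a ⟨v, hv, hmv⟩
  have hmid : ∀ m, m₁ < m → m < m₂ → ∀ z ∈ S, k < d (p m) z := by
    intro m h h' z hz
    by_contra! hle
    rcases le_total m i with hmi | hmi
    · exact hm₁ m h hmi ⟨z, hz, hle⟩
    · exact hm₂ m hmi h' ⟨z, hz, hle⟩
  have hsep : ∀ m, m₁ ≤ m → m ≤ m₂ → ∀ z ∈ S, k ≤ d (p m) z := by
    intro m h h' z hz
    rcases h.eq_or_lt with rfl | h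
    · have e₁ := hmid (m₁ + 1) (by omega) (by omega) z hz
      have e₂ := hd.tri (p (m₁ + 1)) (p m₁) z
      have e₃ := hp.step m₁ (by omega)
      rw [hd.symm] at e₃
      omega
    · rcases h'.eq_or_lt with rfl | h'
      · have e₁ := hmid (m - 1) (by omega) (by omega) z hz
        have e₂ := hd.tri (p (m - 1)) (p m) z
        have e₃ := hp.step (m - 1) (by omega)
        rw [Nat.sub_add_cancel (by omega)] at e₃
        omega
      · exact (hmid m h h' z hz).le
  obtain ⟨δ, n, hδ, hδ0, hδn, hδS⟩ := hside u hu
  obtain ⟨β, n', hβ, hβ0, hβn, hβS⟩ := hside v hv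
  have hw : ∃ w, w ≤ n ∧ ∃ t ≤ n', d (δ w) (β t) ≤ k :=
    ⟨n, le_rfl, n', le_rfl, by rw [hδn, hβn, hd.self]; exact Nat.zero_le _⟩
  obtain ⟨w, ⟨hwn, t, ht, hwt⟩, hmin⟩ : ∃ w, (w ≤ n ∧ ∃ t ≤ n', d (δ w) (β t) ≤ k) ∧
      ∀ w' < w, ∀ t ≤ n', k < d (δ w') (β t) :=
    ⟨Nat.find hw, Nat.find_spec hw, fun w' hw' t ht => by
      by_contra! hle
      exact Nat.find_min hw hw' ⟨hw'.le.trans (Nat.find_spec hw).1, t, ht, hle⟩⟩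
  have hδβ : 0 < w → ∀ x ≤ w, ∀ y ≤ n', k ≤ d (δ x) (β y) := by
    intro hw0 x hx y hy
    rcases hx.eq_or_lt with rfl | hx
    · have e₁ := hmin (x - 1) (by omega) y hy
      have e₂ := hd.tri (δ (x - 1)) (δ x) (β y)
      have e₃ := hδ.step (x - 1) (by omega)
      rw [Nat.sub_add_cancel (by omega)] at e₃
      omega
    · exact (hmin x hx y hy).le
  have hfin := hexagon_le hd hK hP (α := fun m => p (m₁ + m)) (a := m₂ - m₁) (β := β) (b := t)
    (γ := fun m => δ (w - m)) (c := w) hk (hp.shift (by omega)) (hβ.mono ht) (hδ.reverse hd hwn)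
    (Or.inr <| Or.inr fun x hx y hy => hsep _ (by omega) (by omega) _ (hβS y (hy.trans ht)))
    (by
      rcases Nat.eq_zero_or_pos w with h | h
      · exact Or.inr (Or.inl h)
      · refine Or.inr (Or.inr fun x hx y hy => ?_)
        rw [hd.symm]
        exact hδβ h _ (by omega) _ (hx.trans ht))
    (Or.inr <| Or.inr fun x hx y hy => by
      rw [hd.symm]
      exact hsep _ (by omega) (by omega) _ (hδS _ (by omega)))
    (by rw [show m₁ + (m₂ - m₁) = m₂ by omega, hβ0]; exact hmv)
    (by rw [Nat.sub_zero, hd.symm]; exact hwt)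
    (by rw [Nat.sub_self, hδ0, hd.symm]; exact hmu)
  omega

/-- A `1`-Lipschitz function on a subset extends to the whole space. -/
lemma exists_lipschitz_extension (hd : IsGraphDist d) {W : Type*} [Nonempty W]
    (i : W → V) (f : W → ℝ) (hf : ∀ x y, f x ≤ f y + d (i x) (i y)) :
    ∃ f' : V → ℝ, (∀ x, f' (i x) = f x) ∧ NatLipschitz d f' := by
  have hbdd : ∀ z, BddBelow (Set.range fun x => f x + d (i x) z) := by
    intro z
    obtain ⟨x₀⟩ := ‹Nonempty W›
    refine ⟨f x₀ - d (i x₀) z, ?_⟩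
    rintro _ ⟨x, rfl⟩
    have h₁ := hf x₀ x
    have h₂ : (d (i x₀) (i x) : ℝ) ≤ d (i x₀) z + d (i x) z := by
      rw [hd.symm (i x)]
      exact_mod_cast hd.tri _ _ _
    dsimp only
    linarith
  refine ⟨fun z => ⨅ x, (f x + d (i x) z), fun x => le_antisymm ?_ ?_, fun y z => ?_⟩
  · exact (ciInf_le (hbdd _) x).trans (by simp [hd.self])
  · refine le_ciInf fun y => ?_
    rw [hd.symm]
    exact hf x y
  · rw [← sub_le_iff_le_add]
    refine le_ciInf fun x => ?_
    have h₁ := ciInf_le (hbdd y) x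
    have h₂ : (d (i x) y : ℝ) ≤ d (i x) z + d y z := by
      rw [hd.symm y]
      exact_mod_cast hd.tri _ _ _
    dsimp only at h₁ ⊢
    linarith

end ThinTriangles

section WordMetric

variable {G : Type*} [Group G] {S : Set G}

lemma wordLength_prod_le {w : List G} (hw : ∀ x ∈ w, x ∈ S ∨ x⁻¹ ∈ S) :
    wordLength S w.prod ≤ w.length :=
  Nat.sInf_le ⟨w, rfl, hw, rfl⟩

lemma wordLength_one : wordLength S (1 : G) = 0 :=
  Nat.le_zero.1 (wordLength_prod_le (w := []) (by simp))

lemma wordLength_le_one {x : G} (hx : x ∈ S ∨ x⁻¹ ∈ S) : wordLength S x ≤ 1 := by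
  simpa using wordLength_prod_le (S := S) (w := [x]) (by simpa using hx)

lemma exists_word (hS : Subgroup.closure S = ⊤) (g : G) :
    ∃ w : List G, w.length = wordLength S g ∧ (∀ x ∈ w, x ∈ S ∨ x⁻¹ ∈ S) ∧ w.prod = g := by
  obtain ⟨w, hw, hg⟩ := Submonoid.exists_list_of_mem_closure (s := S ∪ S⁻¹) (x := g)
    (by rw [← Subgroup.closure_toSubmonoid, hS]; trivial)
  exact Nat.sInf_mem
    (s := {n | ∃ w : List G, w.length = n ∧ (∀ x ∈ w, x ∈ S ∨ x⁻¹ ∈ S) ∧ w.prod = g})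
    ⟨_, w, rfl, hw, hg⟩

lemma wordLength_mul_le (hS : Subgroup.closure S = ⊤) (g h : G) :
    wordLength S (g * h) ≤ wordLength S g + wordLength S h := by
  obtain ⟨v, hv, hv', rfl⟩ := exists_word hS g
  obtain ⟨w, hw, hw', rfl⟩ := exists_word hS h
  rw [← hv, ← hw, ← List.prod_append, ← List.length_append]
  refine wordLength_prod_le fun x hx => ?_
  rcases List.mem_append.1 hx with h | h
  · exact hv' x h
  · exact hw' x h

lemma wordLength_inv_le (hS : Subgroup.closure S = ⊤) (g : G) :
    wordLength S g⁻¹ ≤ wordLength S g := by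
  obtain ⟨v, hv, hv', rfl⟩ := exists_word hS g
  rw [← hv, List.prod_inv_reverse]
  refine (wordLength_prod_le fun x hx => ?_).trans (by simp)
  obtain ⟨y, hy, rfl⟩ := List.mem_map.1 (List.mem_reverse.1 hx)
  rw [inv_inv]
  exact (hv' y hy).symm

lemma mem_of_wordLength_le_one (hS : Subgroup.closure S = ⊤) {g : G} (hg : wordLength S g ≤ 1) :
    g = 1 ∨ g ∈ S ∨ g⁻¹ ∈ S := by
  obtain ⟨w, hw, hw', rfl⟩ := exists_word hS g
  rw [← hw] at hg
  match w, hg with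
  | [], _ => simp
  | [x], _ => right; simpa using hw'

lemma xDist_self (g : G) : xDist S g g = 0 := by
  rw [xDist, inv_mul_cancel, wordLength_one]

lemma xDist_comm (hS : Subgroup.closure S = ⊤) (g h : G) : xDist S g h = xDist S h g := by
  have key : ∀ g h : G, xDist S g h ≤ xDist S h g := fun g h => by
    have := wordLength_inv_le hS (h⁻¹ * g)
    rwa [mul_inv_rev, inv_inv] at this
  exact le_antisymm (key g h) (key h g)

lemma xDist_triangle (hS : Subgroup.closure S = ⊤) (x y z : G) :
    xDist S x z ≤ xDist S x y + xDist S y z := by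
  have := wordLength_mul_le hS (x⁻¹ * y) (y⁻¹ * z)
  rwa [show x⁻¹ * y * (y⁻¹ * z) = x⁻¹ * z by group] at this

lemma isGraphDist_xDist (hS : Subgroup.closure S = ⊤) : IsGraphDist (xDist S) where
  self := xDist_self
  symm := xDist_comm hS
  tri := xDist_triangle hS
  path x y := by
    obtain ⟨w, hw, hw', hp⟩ := exists_word hS (x⁻¹ * y)
    refine ⟨fun m => x * (w.take m).prod, by simp, ?_, fun m hm => ?_⟩
    · dsimp only
      rw [xDist, ← hw, List.take_length, hp, mul_inv_cancel_left]
    · rw [xDist, ← hw] at hm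
      dsimp only
      rw [xDist, List.prod_take_succ _ _ hm,
        show (x * (w.take m).prod)⁻¹ * (x * ((w.take m).prod * w[m])) = w[m] by group]
      exact wordLength_le_one (hw' _ (List.getElem_mem hm))

lemma finite_wordLength_le (hS : Subgroup.closure S = ⊤) (hfin : S.Finite) (n : ℕ) :
    {g : G | wordLength S g ≤ n}.Finite := by
  have : Finite ↥(S ∪ S⁻¹) := (hfin.union hfin.inv).to_subtype
  have h := List.finite_length_le ↥(S ∪ S⁻¹) n
  refine (h.image fun w => (w.map Subtype.val).prod).subset fun g hg => ?_
  obtain ⟨w, hw, hw', rfl⟩ := exists_word hS g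
  refine ⟨w.attach.map fun x => ⟨x.1, by simpa using hw' x.1 x.2⟩, ?_, ?_⟩
  · simpa [hw] using hg
  · simp [Function.comp_def]

end WordMetric

section Quasiconvex

variable {G : Type*} [Group G] {Λ : Type*} {H : Λ → Subgroup G} {X : Set G}

lemma RelLetter.val_mem (a : RelLetter H X) :
    (a.val ∈ X ∨ a.val⁻¹ ∈ X) ∨ ∃ l, a.val ∈ H l := by
  match a with
  | Sum.inl ⟨l, h⟩ => exact Or.inr ⟨l, h.1.2⟩
  | Sum.inr (x, true) => exact Or.inl (Or.inl (by simp [RelLetter.val]))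
  | Sum.inr (x, false) => exact Or.inl (Or.inr (by simp [RelLetter.val]))

lemma relDist_mul_val_le (u : G) (a : RelLetter H X) : relDist H X u (u * a.val) ≤ 1 := by
  rw [relDist, inv_mul_cancel_left]
  refine wordLength_le_one ?_
  rcases a.val_mem with (h | h) | ⟨l, h⟩
  · exact Or.inl (Or.inl h)
  · exact Or.inr (Or.inl h)
  · exact Or.inl (Or.inr (Set.mem_iUnion.2 ⟨l, h⟩))

lemma exists_letter_of_mem {x : G} (hx : x ∈ X ∪ ⋃ l, (H l : Set G)) :
    x = 1 ∨ ∃ a : RelLetter H X, a.val = x := by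
  rcases hx with h | h
  · exact Or.inr ⟨Sum.inr (⟨x, h⟩, true), by simp [RelLetter.val]⟩
  · obtain ⟨l, h⟩ := Set.mem_iUnion.1 h
    by_cases h1 : x = 1
    · exact Or.inl h1
    · exact Or.inr ⟨Sum.inl ⟨l, ⟨x, h⟩, fun h' => h1 (congrArg Subtype.val h')⟩, rfl⟩

lemma RelLetter.exists_val_inv (a : RelLetter H X) : ∃ b : RelLetter H X, b.val = a.val⁻¹ := by
  match a with
  | Sum.inl ⟨l, h⟩ => exact ⟨Sum.inl ⟨l, h.1⁻¹, inv_ne_one.2 h.2⟩, rfl⟩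
  | Sum.inr (x, b) => exact ⟨Sum.inr (x, !b), by cases b <;> simp [RelLetter.val]⟩

lemma exists_letters (w : List G)
    (hw : ∀ x ∈ w, x ∈ X ∪ ⋃ l, (H l : Set G) ∨ x⁻¹ ∈ X ∪ ⋃ l, (H l : Set G)) :
    ∃ v : List (RelLetter H X), v.length ≤ w.length ∧ (v.map RelLetter.val).prod = w.prod := by
  induction w with
  | nil => exact ⟨[], by simp⟩
  | cons x w ih =>
    obtain ⟨v, hv, hv'⟩ := ih fun y hy => hw y (List.mem_cons_of_mem _ hy)
    have hx : x = 1 ∨ ∃ a : RelLetter H X, a.val = x := by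
      rcases hw x List.mem_cons_self with h | h
      · exact exists_letter_of_mem h
      · rcases exists_letter_of_mem h with h | ⟨a, h⟩
        · exact Or.inl (inv_eq_one.1 h)
        · obtain ⟨b, hb⟩ := a.exists_val_inv
          exact Or.inr ⟨b, by rw [hb, h, inv_inv]⟩
    rcases hx with rfl | ⟨a, rfl⟩
    · exact ⟨v, hv.trans (by simp), by simpa using hv'⟩
    · exact ⟨a :: v, by simpa using hv, by simp [hv']⟩

namespace RelPath

lemma vertex_zero (p : RelPath H X) : p.vertex 0 = p.start := by simp [vertex]

lemma exists_vertex_succ (p : RelPath H X) {k : ℕ} (hk : k < p.len) :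
    ∃ a : RelLetter H X, p.vertex (k + 1) = p.vertex k * a.val := by
  refine ⟨p.word[k], ?_⟩
  simp only [vertex]
  rw [List.take_add_one, List.getElem?_eq_getElem hk]
  simp [mul_assoc]

end RelPath

lemma closure_union_eq_top (hX : Subgroup.closure X = ⊤) :
    Subgroup.closure (X ∪ ⋃ l, (H l : Set G)) = ⊤ :=
  top_le_iff.1 (hX ▸ Subgroup.closure_mono Set.subset_union_left)

lemma isGraphDist_relDist (hX : Subgroup.closure X = ⊤) : IsGraphDist (relDist H X) :=
  isGraphDist_xDist (closure_union_eq_top hX)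

lemma exists_geodesic (hX : Subgroup.closure X = ⊤) (g : G) :
    ∃ p : RelPath H X, p.start = 1 ∧ p.finish = g ∧ IsGeodesic p ∧ p.len = relLen H X g := by
  have hd := isGraphDist_relDist (H := H) hX
  obtain ⟨w, hw, hw', hg⟩ := exists_word (closure_union_eq_top (H := H) hX) g
  obtain ⟨v, hv, hv'⟩ := exists_letters w hw'
  set p : RelPath H X := ⟨1, v⟩
  have hfin : p.finish = g := by simp [RelPath.finish, RelPath.vertex, p, hv', hg]
  have hle : ∀ i n, i + n ≤ p.len → relDist H X (p.vertex i) (p.vertex (i + n)) ≤ n := by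
    intro i n
    induction n with
    | zero => simp [hd.self]
    | succ n ih =>
      intro h
      obtain ⟨a, ha⟩ := p.exists_vertex_succ (k := i + n) (by omega)
      have h₁ := hd.tri (p.vertex i) (p.vertex (i + n)) (p.vertex (i + n + 1))
      have h₂ := relDist_mul_val_le (p.vertex (i + n)) a
      rw [← ha] at h₂
      have h₃ := ih (by omega)
      rw [← add_assoc]
      omega
  have hlen : p.len ≤ relDist H X (p.vertex 0) (p.vertex p.len) := by
    rw [show p.vertex p.len = g from hfin, p.vertex_zero, relDist,
      show p.start = 1 from rfl, inv_one, one_mul, ← hw]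
    exact hv
  have hdist : relDist H X (p.vertex 0) (p.vertex p.len) = relLen H X g := by
    rw [show p.vertex p.len = g from hfin, p.vertex_zero, relDist,
      show p.start = 1 from rfl, inv_one, one_mul, relLen]
  refine ⟨p, rfl, hfin, fun i j hij hj => ?_, ?_⟩
  · have h₁ := hle 0 i (by omega)
    have h₂ := hle i (j - i) (by omega)
    have h₃ := hle j (p.len - j) (by omega)
    rw [zero_add] at h₁
    rw [show i + (j - i) = j by omega] at h₂
    rw [show j + (p.len - j) = p.len by omega] at h₃
    have h₄ := hd.tri (p.vertex 0) (p.vertex i) (p.vertex p.len)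
    have h₅ := hd.tri (p.vertex i) (p.vertex j) (p.vertex p.len)
    omega
  · have h₁ := hle 0 p.len (by omega)
    rw [zero_add] at h₁
    omega

/-- A strongly relatively quasi-convex subgroup has a finite generating set for which the word
length is bounded by the relative length. -/
theorem exists_finite_generators [Finite Λ] (hXfin : X.Finite) (hX : Subgroup.closure X = ⊤)
    {R : Subgroup G} (hR : StronglyRelQuasiconvex H X R) :
    ∃ Y : Set G, Y.Finite ∧ Y ⊆ (R : Set G) ∧ ∀ r : R, ∃ w : List R,
      w.length ≤ relLen H X (r : G) ∧ (∀ x ∈ w, (x : G) ∈ Y) ∧ w.prod = r := by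
  obtain ⟨⟨σ, hσ, hqc⟩, hfinite⟩ := hR
  set B : Set G := {g | wordLength X g ≤ ⌊σ⌋₊} with hB
  have hBfin : B.Finite := finite_wordLength_le hX hXfin _
  set Y : Set G := {y | y ∈ R ∧ ∃ a ∈ B, ∃ b ∈ B, ∃ s : G,
    ((s ∈ X ∨ s⁻¹ ∈ X) ∨ ∃ l, s ∈ H l) ∧ y = a * s * b} with hY
  refine ⟨Y, ?_, fun y hy => hy.1, fun r => ?_⟩
  · have hpiece : ∀ a b : G, ∀ l, {y | y ∈ R ∧ a⁻¹ * y * b⁻¹ ∈ H l}.Finite := by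
      intro a b l
      rcases Set.eq_empty_or_nonempty {y | y ∈ R ∧ a⁻¹ * y * b⁻¹ ∈ H l} with h | ⟨z, hz, hz'⟩
      · rw [h]; exact Set.finite_empty
      · refine ((hfinite a⁻¹ l).image fun x => x * z).subset fun y hy => ?_
        refine ⟨y * z⁻¹, ⟨R.mul_mem hy.1 (R.inv_mem hz), ?_⟩, by simp⟩
        have := (H l).mul_mem hy.2 ((H l).inv_mem hz')
        rwa [show a⁻¹ * y * b⁻¹ * (a⁻¹ * z * b⁻¹)⁻¹ = a⁻¹ * (y * z⁻¹) * a⁻¹⁻¹ by group] at this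
    refine (hBfin.biUnion fun a _ => hBfin.biUnion fun b _ =>
      ((hXfin.union hXfin.inv).image fun s => a * s * b).union
        (Set.finite_iUnion fun l => hpiece a b l)).subset ?_
    rintro y ⟨hyR, a, ha, b, hb, s, hs, rfl⟩
    refine Set.mem_biUnion ha (Set.mem_biUnion hb ?_)
    rcases hs with hs | ⟨l, hs⟩
    · exact Or.inl ⟨s, hs, rfl⟩
    · exact Or.inr (Set.mem_iUnion.2 ⟨l, hyR, by
        rwa [show a⁻¹ * (a * s * b) * b⁻¹ = s by group]⟩)
  · obtain ⟨p, hp0, hp1, hgeo, hlen⟩ := exists_geodesic (H := H) hX (r : G)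
    have hnear : ∀ k ≤ p.len, ∃ w : R, xDist X (p.vertex k) w ≤ ⌊σ⌋₊ := fun k hk => by
      obtain ⟨w, hw, hkw⟩ := hqc p hgeo (hp0 ▸ R.one_mem) (hp1 ▸ r.2) k hk
      exact ⟨⟨w, hw⟩, Nat.le_floor hkw⟩
    have key : ∀ k ≤ p.len, ∀ u : R, xDist X (p.vertex k) u ≤ ⌊σ⌋₊ → ∃ w : List R,
        w.length ≤ k ∧ (∀ x ∈ w, (x : G) ∈ Y) ∧ w.prod = u ∨ k = 0 := by
      intro k
      induction k with
      | zero => exact fun _ _ _ => ⟨[], Or.inr rfl⟩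
      | succ k ih =>
        intro hk u hu
        obtain ⟨a, ha⟩ := p.exists_vertex_succ (k := k) (by omega)
        have step : ∀ v : R, xDist X (p.vertex k) v ≤ ⌊σ⌋₊ → ((v⁻¹ * u : R) : G) ∈ Y := by
          intro v hv
          refine ⟨(v⁻¹ * u).2, (v : G)⁻¹ * p.vertex k, ?_, (p.vertex (k + 1))⁻¹ * u, hu, a.val,
            a.val_mem, ?_⟩
          · rw [xDist_comm hX] at hv
            exact hv
          · rw [ha]
            push_cast
            group
        rcases Nat.eq_zero_or_pos k with rfl | hk0
        · refine ⟨[u], Or.inl ⟨by simp, ?_, by simp⟩⟩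
          have := step 1 (by simp [p.vertex_zero, hp0, xDist_self])
          simpa using this
        · obtain ⟨v, hv⟩ := hnear k (by omega)
          obtain ⟨w, h | h⟩ := ih (by omega) v hv
          · refine ⟨w ++ [v⁻¹ * u], Or.inl ⟨by simpa using h.1, fun x hx => ?_, by simp [h.2.2]⟩⟩
            rcases List.mem_append.1 hx with hx | hx
            · exact h.2.1 x hx
            · rw [List.mem_singleton.1 hx]
              exact step v hv
          · omega
    have hend : p.vertex p.len = r := hp1
    obtain ⟨w, h | h⟩ := key p.len le_rfl r (by rw [hend, xDist_self]; exact Nat.zero_le _)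
    · exact ⟨w, hlen ▸ h⟩
    · refine ⟨[], Nat.zero_le _, by simp, ?_⟩
      rw [h, p.vertex_zero, hp0] at hend
      exact Subtype.ext hend

end Quasiconvex

end RelHyp

open RelHyp

/-- Theorem 4.16. Let `G` be generated by a finite set `X` and hyperbolic
relative to `{H₁,…,H_m}`. Every strongly relatively quasi-convex subgroup `R` of `G` is a
hyperbolic group: `R` is generated by a finite set `Y` and the Cayley graph `Γ(R, Y)` is a
hyperbolic metric space. -/
theorem statement_16 {G : Type*} [Group G] {m : ℕ} (H : Fin m → Subgroup G)
    (X : Set G) (hXfin : X.Finite) (hXgen : Subgroup.closure X = ⊤)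
    (hhyp : IsRelHyperbolic H) (R : Subgroup G)
    (hR : StronglyRelQuasiconvex H X R) :
    ∃ Y : Set G, Y.Finite ∧ Y ⊆ (R : Set G) ∧ Subgroup.closure Y = R ∧
      CayleyHyperbolic (G := ↥R) (fun e : Empty => e.elim) {y : ↥R | (y : G) ∈ Y} := by
  obtain ⟨X', P, hP, A, B, hAB⟩ := hhyp
  obtain ⟨Y, hYfin, hYR, hY⟩ := exists_finite_generators hXfin hXgen hR
  set Z : Set R := {y : ↥R | (y : G) ∈ Y} with hZ
  have hZgen : Subgroup.closure Z = ⊤ := by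
    refine top_le_iff.1 fun r _ => ?_
    obtain ⟨w, -, hw, rfl⟩ := hY r
    exact Subgroup.list_prod_mem _ fun x hx => Subgroup.subset_closure (hw x hx)
  have hZle : ∀ r : R, wordLength Z r ≤ relLen H X (r : G) := by
    intro r
    obtain ⟨w, hl, hw, rfl⟩ := hY r
    exact (wordLength_prod_le fun x hx => Or.inl (hw x hx)).trans hl
  refine ⟨Y, hYfin, hYR, le_antisymm ((Subgroup.closure_le R).2 hYR) fun r hr => ?_, ?_⟩
  · obtain ⟨w, -, hw, hwr⟩ := hY ⟨r, hr⟩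
    have hwr' : (w.map R.subtype).prod = r := by
      rw [← map_list_prod, hwr]
      rfl
    rw [← hwr']
    refine Subgroup.list_prod_mem _ fun x hx => ?_
    obtain ⟨y, hy, rfl⟩ := List.mem_map.1 hx
    exact Subgroup.subset_closure (hw y hy)
  have hdG := isGraphDist_relDist (H := H) hXgen
  have hdR := isGraphDist_xDist hZgen
  have hrel : ∀ x y : R, relDist (fun e : Empty => e.elim) Z x y = xDist Z x y := fun x y => by
    simp [relDist, xDist]
  obtain ⟨M, hM⟩ := (hP.finX.image fun x => relLen H X x).bddAbove
  obtain ⟨K, hK, hbound⟩ := exists_closed_walk_bound hP hAB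
    (E := insert 1 (Y ∪ Y⁻¹)) ((hYfin.union hYfin.inv).insert 1) ((M : ℝ) + 1)
  have hlip : ∀ f : G → ℝ, NatLipschitz (relDist H X) f → EdgeLipschitz H X' ((M : ℝ) + 1) f := by
    intro f hf
    have key : ∀ x u, relLen H X x ≤ M + 1 → |f (u * x) - f u| ≤ (M : ℝ) + 1 := by
      intro x u hx
      refine (hf.abs_sub_le hdG _ _).trans ?_
      rw [hdG.symm, relDist, inv_mul_cancel_left]
      exact_mod_cast hx
    refine ⟨fun x hx u => key x u ?_, fun l h hh u => key h u ?_⟩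
    · exact (hM (Set.mem_image_of_mem _ hx)).trans (Nat.le_succ M)
    · exact (wordLength_le_one (S := X ∪ ⋃ l, (H l : Set G))
        (Or.inl (Or.inr (Set.mem_iUnion.2 ⟨l, hh⟩)))).trans
        (Nat.le_add_left 1 M)
  have hext : ∀ f : R → ℝ, NatLipschitz (xDist Z) f →
      ∃ f' : G → ℝ, (∀ x : R, f' x = f x) ∧ NatLipschitz (relDist H X) f' := fun f hf =>
    exists_lipschitz_extension hdG Subtype.val f fun x y => (hf x y).trans (by
      gcongr
      exact hZle (x⁻¹ * y))
  have hCW : ClosedWalkBound (xDist Z) K := by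
    intro f g hf hg a n s hw
    obtain ⟨f', hf', hf'l⟩ := hext f hf
    obtain ⟨g', hg', hg'l⟩ := hext g hg
    refine hbound f' g' (hlip f' hf'l) (hlip g' hg'l) a n s
      (hw.map (fun x : R => (x : G)) (fun x y hxy => ?_) hf' hg')
    rcases mem_of_wordLength_le_one hZgen hxy with h | h | h
    · exact Or.inl (by simpa using congrArg Subtype.val h)
    · exact Or.inr (Or.inl (by simpa [hZ] using h))
    · exact Or.inr (Or.inr (by simpa [hZ] using h))
  obtain ⟨k, hk⟩ := exists_nat_gt (6 * K)
  refine ⟨6 * k, by positivity, fun p q r hp hq hr hpq hqr hrp i hi => ?_⟩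
  have hgeod : ∀ p : RelPath (fun e : Empty => e.elim) Z, IsGeodesic p →
      GeodSeq (xDist Z) p.vertex p.len :=
    fun p hp i j hij hj => by rw [← hrel, ← hp i j hij hj]
  obtain ⟨j, h⟩ := thin_of_closedWalkBound hdR hK hCW hk (hgeod p hp) (hgeod q hq) (hgeod r hr)
    (hpq.trans q.vertex_zero.symm) (hqr.trans r.vertex_zero.symm)
    (hrp.trans p.vertex_zero.symm) hi
  refine ⟨j, ?_⟩
  rw [hrel, hrel]
  exact_mod_cast h
end

section
/- If P and R are two relatively quasi-convex subgroups of G, then the intersection P ∩ R is a relatively quasi-convex subgroup of G. -/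
namespace RelHyp

theorem exists_word_of_closure_eq_top {G : Type*} [Group G] {S : Set G}
    (hS : Subgroup.closure S = ⊤) (g : G) :
    ∃ w : List G, w.length = wordLength S g ∧ (∀ x ∈ w, x ∈ S ∨ x⁻¹ ∈ S) ∧ w.prod = g := by
  have hne : {n | ∃ w : List G, w.length = n ∧ (∀ x ∈ w, x ∈ S ∨ x⁻¹ ∈ S) ∧
      w.prod = g}.Nonempty := by
    have hg : g ∈ Submonoid.closure (S ∪ S⁻¹) := by
      rw [← Subgroup.closure_toSubmonoid, hS]
      exact Subgroup.mem_top g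
    obtain ⟨w, hw, hprod⟩ := Submonoid.exists_list_of_mem_closure hg
    exact ⟨w.length, w, rfl, fun x hx => by simpa using hw x hx, hprod⟩
  exact Nat.sInf_mem hne

/-- Balls of the word metric of a finite generating set are finite. -/
theorem finite_setOf_wordLength_le {G : Type*} [Group G] {S : Set G} (hfin : S.Finite)
    (hS : Subgroup.closure S = ⊤) (n : ℕ) : {g : G | wordLength S g ≤ n}.Finite := by
  have hA : (S ∪ S⁻¹).Finite := hfin.union hfin.inv
  have : Finite ↥(S ∪ S⁻¹) := hA
  refine ((List.finite_length_le ↥(S ∪ S⁻¹) n).image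
    fun w => (w.map Subtype.val).prod).subset fun g hg => ?_
  obtain ⟨w, hlen, hw, rfl⟩ := exists_word_of_closure_eq_top hS g
  lift w to List ↥(S ∪ S⁻¹) using fun x hx => by simpa using hw x hx
  refine ⟨w, ?_, rfl⟩
  rw [List.length_map] at hlen
  exact hlen.trans_le hg

/-- A point of the intersection of bounded neighbourhoods of two subgroups is at bounded
distance from the intersection of the subgroups. -/
theorem exists_xDist_inf_le {G : Type*} [Group G] {S : Set G} (hfin : S.Finite)
    (hS : Subgroup.closure S = ⊤) (P R : Subgroup G) (m n : ℕ) :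
    ∃ N : ℕ, ∀ v : G, (∃ p ∈ P, xDist S v p ≤ m) → (∃ r ∈ R, xDist S v r ≤ n) →
      ∃ w ∈ P ⊓ R, xDist S v w ≤ N := by
  classical
  have hsel : ∀ q : G × G, ∃ u : G, (∃ t, q.1⁻¹ * t ∈ P ∧ q.2⁻¹ * t ∈ R) →
      q.1⁻¹ * u ∈ P ∧ q.2⁻¹ * u ∈ R := fun q => by
    by_cases h : ∃ t, q.1⁻¹ * t ∈ P ∧ q.2⁻¹ * t ∈ R
    · exact ⟨h.choose, fun _ => h.choose_spec⟩
    · exact ⟨1, fun h' => absurd h' h⟩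
  choose f hf using hsel
  obtain ⟨N, hN⟩ := (((finite_setOf_wordLength_le hfin hS m).prod
    (finite_setOf_wordLength_le hfin hS n)).image fun q => wordLength S (f q)).bddAbove
  refine ⟨N, fun v ⟨p, hp, hvp⟩ ⟨r, hr, hvr⟩ => ?_⟩
  obtain ⟨h₁, h₂⟩ := hf (v⁻¹ * p, v⁻¹ * r)
    ⟨v⁻¹, by simpa [mul_assoc] using hp, by simpa [mul_assoc] using hr⟩
  refine ⟨v * f (v⁻¹ * p, v⁻¹ * r), ⟨?_, ?_⟩, ?_⟩
  · simpa [mul_assoc] using P.mul_mem hp h₁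
  · simpa [mul_assoc] using R.mul_mem hr h₂
  · rw [xDist, inv_mul_cancel_left]
    exact hN ⟨(v⁻¹ * p, v⁻¹ * r), ⟨hvp, hvr⟩, rfl⟩

end RelHyp

open RelHyp

/-- Proposition 4.18. Let `G` be generated by a finite set `X` and hyperbolic
relative to `{H₁,…,H_m}`. If `P` and `R` are relatively quasi-convex subgroups of `G`, then so
is `P ∩ R`. -/
theorem statement_17 {G : Type*} [Group G] {m : ℕ} (H : Fin m → Subgroup G)
    (X : Set G) (hXfin : X.Finite) (hXgen : Subgroup.closure X = ⊤)
    (hhyp : IsRelHyperbolic H) (P R : Subgroup G)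
    (hP : RelQuasiconvex H X P) (hR : RelQuasiconvex H X R) :
    RelQuasiconvex H X (P ⊓ R) := by
  obtain ⟨σ, _, hσP⟩ := hP
  obtain ⟨τ, _, hτR⟩ := hR
  obtain ⟨N, hN⟩ := exists_xDist_inf_le hXfin hXgen P R ⌊σ⌋₊ ⌊τ⌋₊
  refine ⟨N + 1, by positivity, fun p hp hs hf k hk => ?_⟩
  obtain ⟨a, ha, hpa⟩ := hσP p hp hs.1 hf.1 k hk
  obtain ⟨b, hb, hpb⟩ := hτR p hp hs.2 hf.2 k hk
  obtain ⟨w, hw, hpw⟩ := hN (p.vertex k) ⟨a, ha, Nat.le_floor hpa⟩ ⟨b, hb, Nat.le_floor hpb⟩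
  exact ⟨w, hw, by exact_mod_cast hpw.trans (Nat.le_succ N)⟩
end
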